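/- Let G be a finite simple graph with vertex set V of size n ≥ 4 and minimum degree at least 1, let λ ≥ 1 be a real number such that every nonempty proper subset S' of V satisfies |C(S')| ≥ λ, and let ε ∈ (0,1] be a real number. Let S ⊆ V with 2 ≤ |S| ≤ n - 2 and |C(S)| ≤ (2-ε)·λ. Consider a random 2-out sample of G: independently for each vertex v, choose two uniformly random edges incident to v (with replacement, and independently across vertices). Then the probability that no chosen edge belongs to C(S) equals ∏_{v ∈ V} (1 - c_S(v)/d(v))², and this probability is at least exp(-8(2-ε)/ε). -/

import Mathlib

/-- The cut `C(S)`: the set of edges of `G` with exactly one endpoint in `S`. -/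
def SimpleGraph.cutEdges {V : Type*} [Fintype V] [DecidableEq V] (G : SimpleGraph V)
    [DecidableRel G.Adj] (S : Finset V) : Finset (Sym2 V) :=
  G.edgeFinset.filter (fun e => ∃ a b, e = s(a, b) ∧ a ∈ S ∧ b ∉ S)

/-- `c_S(v)`: the number of edges of the cut `C(S)` incident to the vertex `v`. -/
def SimpleGraph.cutInc {V : Type*} [Fintype V] [DecidableEq V] (G : SimpleGraph V)
    [DecidableRel G.Adj] (S : Finset V) (v : V) : ℕ :=
  ((G.cutEdges S).filter (fun e => v ∈ e)).card

namespace SimpleGraph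

variable {V : Type*} [Fintype V] [DecidableEq V] (G : SimpleGraph V) [DecidableRel G.Adj]

theorem mk_mem_cutEdges (S : Finset V) (a b : V) :
    s(a, b) ∈ G.cutEdges S ↔ G.Adj a b ∧ (a ∈ S ↔ b ∉ S) := by
  simp only [cutEdges, Finset.mem_filter, mem_edgeFinset, mem_edgeSet]
  refine and_congr_right fun _ => ⟨?_, fun h => ?_⟩
  · rintro ⟨x, y, h, hx, hy⟩
    rcases Sym2.eq_iff.1 h with ⟨rfl, rfl⟩ | ⟨rfl, rfl⟩ <;> tauto
  · by_cases ha : a ∈ S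
    · exact ⟨a, b, rfl, ha, h.1 ha⟩
    · exact ⟨b, a, Sym2.eq_swap, by tauto, ha⟩

/-- The non-cut neighbours of `v` together with the cut edges at `v` account for its degree. -/
theorem card_filter_notMem_cutEdges_add_cutInc (S : Finset V) (v : V) :
    ((G.neighborFinset v).filter (fun w => s(v, w) ∉ G.cutEdges S)).card + G.cutInc S v =
      G.degree v := by
  have h : G.cutInc S v =
      ((G.neighborFinset v).filter (fun w => s(v, w) ∈ G.cutEdges S)).card := by
    symm
    refine Finset.card_bij (fun w _ => s(v, w)) ?_ ?_ ?_
    · intro w hw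
      exact Finset.mem_filter.2 ⟨(Finset.mem_filter.1 hw).2, Sym2.mem_mk_left v w⟩
    · intro a _ b _ hab
      exact Sym2.congr_right.1 hab
    · intro e he
      obtain ⟨he, w, rfl⟩ := Finset.mem_filter.1 he
      exact ⟨w, by simpa [he] using ((G.mk_mem_cutEdges S v w).1 he).1, rfl⟩
  rw [h, add_comm, Finset.card_filter_add_card_filter_not, card_neighborFinset_eq_degree]

/-- Every cut edge is counted at both of its endpoints. -/
theorem sum_cutInc (S : Finset V) : ∑ v, G.cutInc S v = 2 * (G.cutEdges S).card := by
  have h := Finset.sum_card_bipartiteAbove_eq_sum_card_bipartiteBelow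
    (s := Finset.univ) (t := G.cutEdges S) (fun (v : V) (e : Sym2 V) => v ∈ e)
  refine h.trans ?_
  rw [mul_comm, ← smul_eq_mul]
  refine Finset.sum_const_nat fun e he => ?_
  induction e with | _ a b =>
  have hab : a ≠ b := ((G.mk_mem_cutEdges S a b).1 he).1.ne
  rw [← Finset.card_pair hab]
  congr 1
  ext v
  simp [Finset.bipartiteBelow]

/-- The effect on the size of a cut of moving the vertex `v` to the other side. -/
theorem card_cutEdges_symmDiff_singleton (S : Finset V) (v : V) :
    (G.cutEdges (symmDiff S {v})).card + 2 * G.cutInc S v =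
      (G.cutEdges S).card + G.degree v := by
  have h_at : (G.cutEdges (symmDiff S {v})).filter (v ∈ ·) =
      G.incidenceFinset v \ (G.cutEdges S).filter (v ∈ ·) := by
    ext e
    by_cases hv : v ∈ e
    · obtain ⟨w, rfl⟩ := hv
      by_cases hw : w = v
      · subst hw
        simp [mk_mem_cutEdges]
      · simp [mk_mem_cutEdges, Finset.mem_symmDiff, hw]
        tauto
    · simp [hv, mem_incidenceFinset, incidenceSet]
  have h_off : (G.cutEdges (symmDiff S {v})).filter (v ∉ ·) =
      (G.cutEdges S).filter (v ∉ ·) := by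
    ext e
    induction e with | _ a b =>
    simp only [Finset.mem_filter, mk_mem_cutEdges, Sym2.mem_iff, Finset.mem_symmDiff,
      Finset.mem_singleton, not_or]
    refine and_congr_left fun ⟨ha, hb⟩ => ?_
    simp [Ne.symm ha, Ne.symm hb]
  have h_sub : (G.cutEdges S).filter (v ∈ ·) ⊆ G.incidenceFinset v := by
    intro e he
    obtain ⟨he, hv⟩ := Finset.mem_filter.1 he
    rw [mem_incidenceFinset]
    exact ⟨mem_edgeFinset.1 (Finset.mem_filter.1 he).1, hv⟩
  have h_card := Finset.card_sdiff_add_card_eq_card h_sub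
  rw [← h_at, card_incidenceFinset_eq_degree] at h_card
  have h₁ := Finset.card_filter_add_card_filter_not (s := G.cutEdges (symmDiff S {v})) (v ∈ ·)
  have h₂ := Finset.card_filter_add_card_filter_not (s := G.cutEdges S) (v ∈ ·)
  rw [h_off] at h₁
  unfold cutInc
  omega

/-- A vertex that can be moved across a small cut has a bounded proportion of cut edges. -/
theorem cutInc_div_degree_le {S : Finset V} {v : V} {lam ε : ℝ} (hv : 0 < G.degree v)
    (hε1 : ε ≤ 1) (hlam : lam ≤ G.degree v)
    (hmove : lam ≤ (G.cutEdges (symmDiff S {v})).card)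
    (hcut : ((G.cutEdges S).card : ℝ) ≤ (2 - ε) * lam) :
    (G.cutInc S v : ℝ) / G.degree v ≤ 1 - ε / 2 := by
  have h : ((G.cutEdges (symmDiff S {v})).card : ℝ) + 2 * G.cutInc S v =
      (G.cutEdges S).card + G.degree v := by
    exact_mod_cast G.card_cutEdges_symmDiff_singleton S v
  rw [div_le_iff₀ (by exact_mod_cast hv)]
  nlinarith

theorem card_cutEdges_singleton (v : V) : (G.cutEdges {v}).card = G.degree v := by
  have h := G.card_cutEdges_symmDiff_singleton ∅ v
  have h_empty : G.cutEdges ∅ = ∅ := by simp [cutEdges]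
  have h_symm : symmDiff ∅ ({v} : Finset V) = {v} := bot_symmDiff _
  simpa [cutInc, h_empty, h_symm] using h

/-- The number of ways to choose two neighbours at every vertex, subject to a condition. -/
theorem card_filter_forall_prod (p : V → V → Prop) [DecidableRel p] :
    (Finset.univ.filter (fun f : V → V × V => ∀ v, p v (f v).1 ∧ p v (f v).2)).card =
      ∏ v, (Finset.univ.filter (p v)).card ^ 2 := by
  have h : Finset.univ.filter (fun f : V → V × V => ∀ v, p v (f v).1 ∧ p v (f v).2) =
      Fintype.piFinset (fun v => Finset.univ.filter (p v) ×ˢ Finset.univ.filter (p v)) := by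
    ext f
    simp
  simp [h, Fintype.card_piFinset, Finset.card_product, sq]

end SimpleGraph

theorem Real.exp_neg_mul_le_one_sub {x ε : ℝ} (hx : 0 ≤ x) (hε : 0 < ε) (hxε : x ≤ 1 - ε / 2) :
    Real.exp (-(2 / ε * x)) ≤ 1 - x := by
  have h_pos : 0 < 1 - x := by linarith
  have h_one := Real.one_sub_inv_le_log_of_pos h_pos
  rw [← Real.le_log_iff_exp_le h_pos]
  refine le_trans ?_ h_one
  have h_inv : (1 - x)⁻¹ ≤ 2 / ε := by
    rw [← inv_div]
    exact inv_anti₀ (by positivity) (by linarith)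
  have h_eq : 1 - (1 - x)⁻¹ = -((1 - x)⁻¹ * x) := by
    field_simp
    ring
  rw [h_eq]
  gcongr

/-- Cut-preservation part of Theorem 2.3.  A random 2-out sample is modelled by a uniformly
random function `f : V → V × V` whose two coordinates at each `v` are adjacent to `v`
(the other endpoints of the two random incident edges chosen at `v`, with replacement).
The probability that no chosen edge lies in the fixed non-singleton `(2-ε)`-minimum cut
`C(S)` equals `∏_{v} (1 - c_S(v)/d(v))²`, and is at least `exp (-8(2-ε)/ε)`. -/
theorem twoOut_preserves_cut {V : Type*} [Fintype V] [DecidableEq V]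
    (G : SimpleGraph V) [DecidableRel G.Adj]
    (hn : 4 ≤ Fintype.card V) (hdeg : ∀ v, 1 ≤ G.degree v)
    (lam : ℝ) (hlam : 1 ≤ lam)
    (hmin : ∀ S' : Finset V, S'.Nonempty → S' ≠ Finset.univ →
      lam ≤ ((G.cutEdges S').card : ℝ))
    (ε : ℝ) (hε0 : 0 < ε) (hε1 : ε ≤ 1)
    (S : Finset V) (hS2 : 2 ≤ S.card) (hS2' : S.card ≤ Fintype.card V - 2)
    (hcut : ((G.cutEdges S).card : ℝ) ≤ (2 - ε) * lam) :
    (((Finset.univ.filter (fun f : V → V × V =>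
          (∀ v, G.Adj v (f v).1 ∧ G.Adj v (f v).2) ∧
            ∀ v, s(v, (f v).1) ∉ G.cutEdges S ∧ s(v, (f v).2) ∉ G.cutEdges S)).card : ℝ) /
        ((Finset.univ.filter (fun f : V → V × V =>
          ∀ v, G.Adj v (f v).1 ∧ G.Adj v (f v).2)).card : ℝ)) =
      ∏ v : V, (1 - (G.cutInc S v : ℝ) / (G.degree v : ℝ)) ^ 2 ∧
    Real.exp (-8 * (2 - ε) / ε) ≤
      ∏ v : V, (1 - (G.cutInc S v : ℝ) / (G.degree v : ℝ)) ^ 2 := by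
  constructor
  · have h_num : Finset.univ.filter (fun f : V → V × V =>
          (∀ v, G.Adj v (f v).1 ∧ G.Adj v (f v).2) ∧
            ∀ v, s(v, (f v).1) ∉ G.cutEdges S ∧ s(v, (f v).2) ∉ G.cutEdges S) =
        Finset.univ.filter (fun f : V → V × V =>
          ∀ v, (G.Adj v (f v).1 ∧ s(v, (f v).1) ∉ G.cutEdges S) ∧
            (G.Adj v (f v).2 ∧ s(v, (f v).2) ∉ G.cutEdges S)) := by
      ext f
      simp only [Finset.mem_filter, Finset.mem_univ, true_and, ← forall_and]
      exact forall_congr' fun v => and_and_and_comm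
    rw [h_num, SimpleGraph.card_filter_forall_prod
        (fun v w => G.Adj v w ∧ s(v, w) ∉ G.cutEdges S),
      SimpleGraph.card_filter_forall_prod G.Adj]
    push_cast
    rw [← Finset.prod_div_distrib]
    refine Finset.prod_congr rfl fun v _ => ?_
    have h_count := G.card_filter_notMem_cutEdges_add_cutInc S v
    rw [SimpleGraph.neighborFinset_eq_filter, Finset.filter_filter] at h_count
    have h_deg : (Finset.univ.filter (G.Adj v)).card = G.degree v := by
      rw [← SimpleGraph.neighborFinset_eq_filter, SimpleGraph.card_neighborFinset_eq_degree]
    have h_pos : (0 : ℝ) < G.degree v := by exact_mod_cast hdeg v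
    rw [h_deg, ← div_pow, one_sub_div h_pos.ne', ← h_count]
    push_cast
    rw [add_sub_cancel_right]
  · have h_lam (v : V) : lam ≤ G.degree v := by
      rw [← G.card_cutEdges_singleton v]
      refine hmin _ (Finset.singleton_nonempty v) fun h => ?_
      have := congrArg Finset.card h
      rw [Finset.card_singleton, Finset.card_univ] at this
      omega
    have h_move (v : V) : lam ≤ ((G.cutEdges (symmDiff S {v})).card : ℝ) := by
      refine hmin _ ?_ fun h => ?_
      · obtain ⟨w, hw, hwv⟩ := Finset.exists_mem_ne hS2 v
        exact ⟨w, by simp [Finset.mem_symmDiff, hw, hwv]⟩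
      · have hS : Sᶜ ⊆ {v} := by
          intro w hw
          have := h ▸ Finset.mem_univ w
          simp only [Finset.mem_symmDiff, Finset.mem_compl] at this hw ⊢
          tauto
        have := Finset.card_le_card hS
        rw [Finset.card_compl, Finset.card_singleton] at this
        omega
    have h_sum : ∑ v, (G.cutInc S v : ℝ) / G.degree v ≤ 2 * (2 - ε) := by
      have h_total : ∑ v, (G.cutInc S v : ℝ) = 2 * (G.cutEdges S).card := by
        exact_mod_cast G.sum_cutInc S
      calc ∑ v, (G.cutInc S v : ℝ) / G.degree v ≤ ∑ v, (G.cutInc S v : ℝ) / lam :=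
            Finset.sum_le_sum fun v _ =>
              div_le_div_of_nonneg_left (by positivity) (by linarith) (h_lam v)
        _ ≤ 2 * (2 - ε) := by
            rw [← Finset.sum_div, h_total, div_le_iff₀ (by linarith)]
            linarith
    calc Real.exp (-8 * (2 - ε) / ε)
        ≤ Real.exp (∑ v, -(2 / ε * ((G.cutInc S v : ℝ) / G.degree v))) ^ 2 := by
          rw [← Real.exp_nat_mul, Finset.sum_neg_distrib, ← Finset.mul_sum]
          refine Real.exp_le_exp.2 ?_
          have h := mul_le_mul_of_nonneg_left h_sum (by positivity : 0 ≤ 4 / ε)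
          have h₁ : -8 * (2 - ε) / ε = -(4 / ε * (2 * (2 - ε))) := by ring
          rw [h₁]
          push_cast
          linear_combination h
      _ ≤ _ := by
          rw [Real.exp_sum, ← Finset.prod_pow]
          refine Finset.prod_le_prod (fun v _ => by positivity) fun v _ => ?_
          gcongr
          exact Real.exp_neg_mul_le_one_sub (by positivity) hε0
            (G.cutInc_div_degree_le (hdeg v) hε1 (h_lam v) (h_move v) hcut)
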